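/- Assume that μ is an isomorphism. Then the F-vector space M has finite dimension. -/

import Mathlib

open Polynomial

noncomputable section

/-- The polynomial `τ_i = (λ−θ_0)(λ−θ_1)⋯(λ−θ_{i−1})`. -/
def tauPoly {F : Type*} [Field F] (θ : ℕ → F) (i : ℕ) : Polynomial F :=
  ∏ j ∈ Finset.range i, (X - C (θ j))

/-- The polynomial `η_i = (λ−θ_d)(λ−θ_{d−1})⋯(λ−θ_{d−i+1})`. -/
def etaPoly {F : Type*} [Field F] (d : ℕ) (θ : ℕ → F) (i : ℕ) : Polynomial F :=
  ∏ j ∈ Finset.range i, (X - C (θ (d - j)))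

/-- Generators of the algebra `T`: `a`, `a*`, `e_0,…,e_d`, `e*_0,…,e*_d`. -/
inductive TGen (d : ℕ) : Type
  | a : TGen d
  | astar : TGen d
  | e : Fin (d + 1) → TGen d
  | estar : Fin (d + 1) → TGen d

/-- The defining relations of the algebra `T`. -/
inductive TRel (F : Type*) [Field F] (d : ℕ) (θ θs : ℕ → F) :
    FreeAlgebra F (TGen d) → FreeAlgebra F (TGen d) → Prop
  | ee (i j : Fin (d + 1)) :
      TRel F d θ θs (FreeAlgebra.ι F (TGen.e i) * FreeAlgebra.ι F (TGen.e j))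
        (if i = j then FreeAlgebra.ι F (TGen.e i) else 0)
  | eses (i j : Fin (d + 1)) :
      TRel F d θ θs (FreeAlgebra.ι F (TGen.estar i) * FreeAlgebra.ι F (TGen.estar j))
        (if i = j then FreeAlgebra.ι F (TGen.estar i) else 0)
  | sum_e : TRel F d θ θs (∑ i : Fin (d + 1), FreeAlgebra.ι F (TGen.e i)) 1
  | sum_estar : TRel F d θ θs (∑ i : Fin (d + 1), FreeAlgebra.ι F (TGen.estar i)) 1
  | a_eq : TRel F d θ θs (FreeAlgebra.ι F TGen.a)
      (∑ i : Fin (d + 1), θ (i : ℕ) • FreeAlgebra.ι F (TGen.e i))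
  | astar_eq : TRel F d θ θs (FreeAlgebra.ι F TGen.astar)
      (∑ i : Fin (d + 1), θs (i : ℕ) • FreeAlgebra.ι F (TGen.estar i))
  | trid (i j : Fin (d + 1)) (k : ℕ) (hk : k ≤ d)
      (h : k < max ((i : ℕ) - (j : ℕ)) ((j : ℕ) - (i : ℕ))) :
      TRel F d θ θs (FreeAlgebra.ι F (TGen.estar i) * FreeAlgebra.ι F TGen.a ^ k *
        FreeAlgebra.ι F (TGen.estar j)) 0
  | tridstar (i j : Fin (d + 1)) (k : ℕ) (hk : k ≤ d)
      (h : k < max ((i : ℕ) - (j : ℕ)) ((j : ℕ) - (i : ℕ))) :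
      TRel F d θ θs (FreeAlgebra.ι F (TGen.e i) * FreeAlgebra.ι F TGen.astar ^ k *
        FreeAlgebra.ι F (TGen.e j)) 0

/-- The `F`-algebra `T` presented by the above generators and relations. -/
abbrev TAlg (F : Type*) [Field F] (d : ℕ) (θ θs : ℕ → F) : Type _ :=
  RingQuot (TRel F d θ θs)

/-- The image in `T` of a generator. -/
def tgen (F : Type*) [Field F] (d : ℕ) (θ θs : ℕ → F) (g : TGen d) : TAlg F d θ θs :=
  RingQuot.mkAlgHom F (TRel F d θ θs) (FreeAlgebra.ι F g)

/-- The element `a` of `T`. -/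
def aT (F : Type*) [Field F] (d : ℕ) (θ θs : ℕ → F) : TAlg F d θ θs :=
  tgen F d θ θs TGen.a

/-- The element `a*` of `T`. -/
def asT (F : Type*) [Field F] (d : ℕ) (θ θs : ℕ → F) : TAlg F d θ θs :=
  tgen F d θ θs TGen.astar

/-- The element `e_i` of `T` (defined to be `0` for `i > d`). -/
def eT (F : Type*) [Field F] (d : ℕ) (θ θs : ℕ → F) (i : ℕ) : TAlg F d θ θs :=
  if h : i < d + 1 then tgen F d θ θs (TGen.e ⟨i, h⟩) else 0

/-- The element `e*_i` of `T` (defined to be `0` for `i > d`). -/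
def esT (F : Type*) [Field F] (d : ℕ) (θ θs : ℕ → F) (i : ℕ) : TAlg F d θ θs :=
  if h : i < d + 1 then tgen F d θ θs (TGen.estar ⟨i, h⟩) else 0

/-- Conditions (i) and (iii): the `θ_i` are mutually distinct, the `θ*_i` are mutually
distinct, and the expressions `(θ_{i-2}−θ_{i+1})/(θ_{i-1}−θ_i)`,
`(θ*_{i-2}−θ*_{i+1})/(θ*_{i-1}−θ*_i)` are equal and independent of `i` for `2 ≤ i ≤ d−1`. -/
def EigCond (F : Type*) [Field F] (d : ℕ) (θ θs : ℕ → F) : Prop :=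
  (∀ i j, i ≤ d → j ≤ d → i ≠ j → θ i ≠ θ j) ∧
  (∀ i j, i ≤ d → j ≤ d → i ≠ j → θs i ≠ θs j) ∧
  ∃ β : F, ∀ i, 2 ≤ i → i + 1 ≤ d →
    θ (i - 2) - θ (i + 1) = β * (θ (i - 1) - θ i) ∧
    θs (i - 2) - θs (i + 1) = β * (θs (i - 1) - θs i)

/-- The subalgebra `D` of `T` generated by `a`, as an `F`-subspace. -/
def Dsub (F : Type*) [Field F] (d : ℕ) (θ θs : ℕ → F) : Submodule F (TAlg F d θ θs) :=
  Subalgebra.toSubmodule (Algebra.adjoin F {aT F d θ θs})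

/-- The subalgebra `D*` of `T` generated by `a*`, as an `F`-subspace. -/
def DsSub (F : Type*) [Field F] (d : ℕ) (θ θs : ℕ → F) : Submodule F (TAlg F d θ θs) :=
  Subalgebra.toSubmodule (Algebra.adjoin F {asT F d θ θs})

end

noncomputable section

/-- A tridiagonal system on `V` of diameter `d`, with data `(A; {E_i}; A*; {E*_i})`,
eigenvalue sequence `θ` and dual eigenvalue sequence `θs`.  The families `E`, `Es` are the
orderings of the primitive idempotents of `A`, `A*` (so the `E_i V` are the eigenspaces of the
diagonalizable map `A`, ordered so that the tridiagonal conditions hold, and similarly for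
`A*`), and the last condition is the irreducibility condition (iv). -/
def IsTDSystem (F : Type*) [Field F] (V : Type*) [AddCommGroup V] [Module F V]
    (d : ℕ) (A As : V →ₗ[F] V) (E Es : ℕ → (V →ₗ[F] V)) (θ θs : ℕ → F) : Prop :=
  FiniteDimensional F V ∧ 0 < Module.finrank F V ∧
  (∀ i j, i ≤ d → j ≤ d → i ≠ j → θ i ≠ θ j) ∧
  (∀ i j, i ≤ d → j ≤ d → i ≠ j → θs i ≠ θs j) ∧
  (∀ i, i ≤ d → E i ≠ 0) ∧
  (∀ i, i ≤ d → Es i ≠ 0) ∧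
  (∀ i j, i ≤ d → j ≤ d → E i ∘ₗ E j = if i = j then E i else 0) ∧
  (∀ i j, i ≤ d → j ≤ d → Es i ∘ₗ Es j = if i = j then Es i else 0) ∧
  (∑ i ∈ Finset.range (d + 1), E i) = LinearMap.id ∧
  (∑ i ∈ Finset.range (d + 1), Es i) = LinearMap.id ∧
  A = ∑ i ∈ Finset.range (d + 1), θ i • E i ∧
  As = ∑ i ∈ Finset.range (d + 1), θs i • Es i ∧
  (∀ i, i ≤ d → Submodule.map As (LinearMap.range (E i)) ≤
    (if i = 0 then ⊥ else LinearMap.range (E (i - 1))) ⊔ LinearMap.range (E i) ⊔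
      (if i = d then ⊥ else LinearMap.range (E (i + 1)))) ∧
  (∀ i, i ≤ d → Submodule.map A (LinearMap.range (Es i)) ≤
    (if i = 0 then ⊥ else LinearMap.range (Es (i - 1))) ⊔ LinearMap.range (Es i) ⊔
      (if i = d then ⊥ else LinearMap.range (Es (i + 1)))) ∧
  (∀ W : Submodule F V, (∀ w ∈ W, A w ∈ W) → (∀ w ∈ W, As w ∈ W) → W = ⊥ ∨ W = ⊤)

/-- A sharp tridiagonal system with parameter array `(θ; θs; ζ)`:  a tridiagonal system
which is sharp (`dim E*_0 V = 1`) and whose split sequence is `ζ`, i.e.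
`E*_0 τ_i(A) E*_0 = ζ_i E*_0 / ((θ*_0−θ*_1)⋯(θ*_0−θ*_i))` for `0 ≤ i ≤ d`. -/
def SharpTDWithArray (F : Type*) [Field F] (V : Type*) [AddCommGroup V] [Module F V]
    (d : ℕ) (A As : V →ₗ[F] V) (E Es : ℕ → (V →ₗ[F] V)) (θ θs ζ : ℕ → F) : Prop :=
  IsTDSystem F V d A As E Es θ θs ∧
  Module.finrank F (LinearMap.range (Es 0)) = 1 ∧
  ∀ i, i ≤ d → Es 0 ∘ₗ (Polynomial.aeval A (tauPoly θ i)) ∘ₗ Es 0 =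
    (ζ i / ∏ h ∈ Finset.Icc 1 i, (θs 0 - θs h)) • Es 0

/-- The action of an element `x` of `T` on a `T`-module `M`, as an `F`-linear map. -/
def actL {F : Type*} [Field F] {d : ℕ} {θ θs : ℕ → F} {M : Type*} [AddCommGroup M]
    [Module F M] [Module (TAlg F d θ θs) M] [IsScalarTower F (TAlg F d θ θs) M]
    (x : TAlg F d θ θs) : M →ₗ[F] M where
  toFun m := x • m
  map_add' := smul_add x
  map_smul' c m := (smul_comm c x m).symm

/-- The `F`-linear map `T → M`, `t ↦ t • v`, for a vector `v` of a `T`-module `M`. -/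
def applyVec {F : Type*} [Field F] {d : ℕ} {θ θs : ℕ → F} {M : Type*} [AddCommGroup M]
    [Module F M] [Module (TAlg F d θ θs) M] [IsScalarTower F (TAlg F d θ θs) M]
    (v : M) : TAlg F d θ θs →ₗ[F] M where
  toFun t := t • v
  map_add' x y := add_smul x y v
  map_smul' c t := smul_assoc c t v

/-- The `F`-subspace `e*_0 T e*_0` of `T`. -/
def corner (F : Type*) [Field F] (d : ℕ) (θ θs : ℕ → F) : Submodule F (TAlg F d θ θs) :=
  LinearMap.range ((LinearMap.mulLeft F (esT F d θ θs 0)).comp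
    (LinearMap.mulRight F (esT F d θ θs 0)))

/-- The properties characterizing the homomorphism `μ : F[x_1,…,x_d] → e*_0 T e*_0`:
it is `F`-linear, unital (with `1 ↦ e*_0`, the identity of `e*_0Te*_0`), multiplicative,
sends `x_i ↦ e*_0 τ_i(a) e*_0` for `1 ≤ i ≤ d`, and is onto `e*_0 T e*_0`. -/
def MuProps (F : Type*) [Field F] (d : ℕ) (θ θs : ℕ → F)
    (μ : MvPolynomial (Fin d) F →ₗ[F] TAlg F d θ θs) : Prop :=
  μ 1 = esT F d θ θs 0 ∧
  (∀ p q, μ (p * q) = μ p * μ q) ∧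
  (∀ i : Fin d, μ (MvPolynomial.X i) =
    esT F d θ θs 0 * (Polynomial.aeval (aT F d θ θs) (tauPoly θ ((i : ℕ) + 1))) *
      esT F d θ θs 0) ∧
  LinearMap.range μ = corner F d θ θs

/-- Conditions (ii) on the split sequence: `ζ_0 = 1`, `ζ_d ≠ 0` and
`Σ_{i=0}^d η_{d−i}(θ_0) η*_{d−i}(θ*_0) ζ_i ≠ 0`. -/
def ZetaCond (F : Type*) [Field F] (d : ℕ) (θ θs : ℕ → F) (ζ : ℕ → F) : Prop :=
  ζ 0 = 1 ∧ ζ d ≠ 0 ∧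
  (∑ i ∈ Finset.range (d + 1),
    (etaPoly d θ (d - i)).eval (θ 0) * (etaPoly d θs (d - i)).eval (θs 0) * ζ i) ≠ 0

/-- The element `g_i = e*_0 τ_i(a) e*_0 − ζ_i e*_0/((θ*_0−θ*_1)⋯(θ*_0−θ*_i))` of `T`. -/
def gElt (F : Type*) [Field F] (d : ℕ) (θ θs : ℕ → F) (ζ : ℕ → F) (i : ℕ) :
    TAlg F d θ θs :=
  esT F d θ θs 0 * (Polynomial.aeval (aT F d θ θs) (tauPoly θ i)) * esT F d θ θs 0 -
    (ζ i / ∏ h ∈ Finset.Icc 1 i, (θs 0 - θs h)) • esT F d θ θs 0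

/-- The left ideal `J = T(1−e*_0) + Σ_{i=1}^d T g_i` of `T`, as a submodule of `T` over
itself (with the left regular action). -/
def Jideal (F : Type*) [Field F] (d : ℕ) (θ θs : ℕ → F) (ζ : ℕ → F) :
    Submodule (TAlg F d θ θs) (TAlg F d θ θs) :=
  Submodule.span (TAlg F d θ θs)
    ({1 - esT F d θ θs 0} ∪ (gElt F d θ θs ζ '' Set.Icc 1 d))

/-- The `F`-subspace `D D* D D* D ⋯ D D* D` of `T` with `n+1` factors `D`. -/
def DDchain (F : Type*) [Field F] (d : ℕ) (θ θs : ℕ → F) : ℕ → Submodule F (TAlg F d θ θs)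
  | 0 => Dsub F d θ θs
  | n + 1 => DDchain F d θ θs n * DsSub F d θ θs * Dsub F d θ θs

/-- The `F`-subspace `e*_r D e*_{κ 1} D e*_{κ 2} ⋯ D e*_{κ m}` of `T`. -/
def esChain (F : Type*) [Field F] (d : ℕ) (θ θs : ℕ → F) (r : ℕ) (κ : ℕ → ℕ) :
    ℕ → Submodule F (TAlg F d θ θs)
  | 0 => Submodule.span F {esT F d θ θs r}
  | m + 1 => esChain F d θ θs r κ m * Dsub F d θ θs *
      Submodule.span F {esT F d θ θs (κ (m + 1))}

/-- The sequence `(c_0, c_1, …, c_m)` is convex: `c_{i−1} − c_i ≥ c_i − c_{i+1}`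
for `1 ≤ i ≤ m−1`. -/
def ConvexSeq (c : ℕ → ℤ) (m : ℕ) : Prop :=
  ∀ i, 1 ≤ i → i + 1 ≤ m → c i - c (i + 1) ≤ c (i - 1) - c i

end

open Finset in
/-- A vector family indexed by distinct nodes `θ j`, supported on at most `n` nodes and with
vanishing moments of order less than `n`, is zero. -/
theorem eq_zero_of_moments_eq_zero {F Q : Type*} [Field F] [AddCommGroup Q] [Module F Q]
    {I : Finset ℕ} {θ : ℕ → F} (hθ : Set.InjOn θ I) {q : ℕ → Q} {n : ℕ}
    (hq : ∀ m < n, ∑ j ∈ I, θ j ^ m • q j = 0) {S : Finset ℕ} (hSI : S ⊆ I) (hS : #S ≤ n)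
    (hsupp : ∀ j ∈ I, j ∉ S → q j = 0) {j : ℕ} (hj : j ∈ I) : q j = 0 := by
  by_cases hjS : j ∈ S
  swap
  · exact hsupp j hj hjS
  have key : ∀ p : F[X], p.natDegree < n → ∑ l ∈ I, p.eval (θ l) • q l = 0 := by
    intro p hp
    simp_rw [eval_eq_sum_range' hp, sum_smul]
    rw [sum_comm]
    refine sum_eq_zero fun m hm => ?_
    simp_rw [mul_smul]
    rw [← smul_sum, hq m (mem_range.1 hm), smul_zero]
  have h := key (∏ l ∈ S.erase j, (X - C (θ l))) (by
    rw [natDegree_finsetProd_X_sub_C_eq_card, card_erase_of_mem hjS]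
    have := card_pos.2 ⟨j, hjS⟩
    omega)
  rw [sum_eq_single_of_mem j hj] at h
  · refine (smul_eq_zero.1 h).resolve_left ?_
    rw [eval_prod]
    refine prod_ne_zero_iff.2 fun l hl => ?_
    rw [eval_sub, eval_X, eval_C, sub_ne_zero]
    exact fun h' => (mem_erase.1 hl).1 (hθ (hSI (mem_erase.1 hl).2) hj h'.symm)
  · intro l hl hlj
    by_cases hlS : l ∈ S
    · rw [eval_prod, prod_eq_zero (mem_erase.2 ⟨hlj, hlS⟩) (by simp), zero_smul]
    · rw [hsupp l hl hlS, smul_zero]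

open Finset in
/-- A matrix of bandwidth `k` whose rows have vanishing moments of order at most `k` and whose
columns have vanishing moments of order less than `k` is zero. -/
theorem eq_zero_of_band_of_moments {F Q : Type*} [Field F] [AddCommGroup Q] [Module F Q]
    {d k : ℕ} {θ : ℕ → F} (hθ : Set.InjOn θ (range (d + 1))) {b : ℕ → ℕ → Q}
    (hband : ∀ i j, i ≤ d → j ≤ d → k < max (i - j) (j - i) → b i j = 0)
    (hrow : ∀ i ≤ d, ∀ m < k + 1, ∑ j ∈ range (d + 1), θ j ^ m • b i j = 0)
    (hcol : ∀ j ≤ d, ∀ m < k, ∑ i ∈ range (d + 1), θ i ^ m • b i j = 0) :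
    ∀ i j, i ≤ d → j ≤ d → b i j = 0 := by
  have key : ∀ n, ∀ i j, i ≤ d → j ≤ d → (i < n ∨ j < n) → b i j = 0 := by
    intro n
    induction n with
    | zero => intro i j _ _ h; omega
    | succ n ih =>
      have row : ∀ j, n ≤ d → j ≤ d → b n j = 0 := by
        intro j hn hj
        refine eq_zero_of_moments_eq_zero hθ (hrow n hn)
          (S := (range (d + 1)).filter (fun j => j ∈ Icc n (n + k))) (filter_subset _ _)
          ?_ ?_ (mem_range.2 (by omega))
        · refine (card_le_card (t := Icc n (n + k)) fun x hx => (mem_filter.1 hx).2).trans ?_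
          simp only [Nat.card_Icc]
          omega
        · intro l hl hlS
          simp only [mem_filter, mem_range, mem_Icc, not_and, not_le] at hl hlS
          by_cases hln : l < n
          · exact ih n l hn (by omega) (Or.inr hln)
          · exact hband n l hn (by omega) (by have := hlS hl (by omega); omega)
      have col : ∀ i, n ≤ d → i ≤ d → b i n = 0 := by
        intro i hn hi
        refine eq_zero_of_moments_eq_zero hθ (q := fun i => b i n) (hcol n hn)
          (S := (range (d + 1)).filter (fun j => j ∈ Icc (n + 1) (n + k))) (filter_subset _ _)
          ?_ ?_ (mem_range.2 (by omega))
        · refine (card_le_card (t := Icc (n + 1) (n + k))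
            fun x hx => (mem_filter.1 hx).2).trans ?_
          simp only [Nat.card_Icc]
          omega
        · intro l hl hlS
          simp only [mem_filter, mem_range, mem_Icc, not_and, not_le] at hl hlS
          rcases lt_trichotomy l n with hln | hln | hln
          · exact ih l n (by omega) hn (Or.inl hln)
          · subst hln
            exact row l hn hn
          · exact hband l n (by omega) hn (by have := hlS hl (by omega); omega)
      intro i j hi hj h
      by_cases hin : i < n
      · exact ih i j hi hj (Or.inl hin)
      by_cases hjn : j < n
      · exact ih i j hi hj (Or.inr hjn)
      rcases h with h | h
      · obtain rfl : i = n := by omega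
        exact row j hi hj
      · obtain rfl : j = n := by omega
        exact col i hj hi
  intro i j hi hj
  exact key (i + 1) i j hi hj (Or.inl (Nat.lt_succ_self i))

section Tridiagonal

variable {F M : Type*} [Field F] [AddCommGroup M] [Module F M]

/-- The tridiagonal condition `S_r A^m S_s = 0` for `m < |r - s|`, where `A = ∑ θ_j E_j` and the
`E_j` are orthogonal idempotents, so that `A^m = ∑ θ_j^m E_j`. -/
def MomentVanishing (d : ℕ) (θ : ℕ → F) (E S : ℕ → Module.End F M) : Prop :=
  ∀ r s m, r ≤ d → s ≤ d → m < max (r - s) (s - r) →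
    ∀ x, ∑ j ∈ Finset.range (d + 1), θ j ^ m • S r (E j (S s x)) = 0

open Finset in
/-- If `r ≤ s` and `t < s` then `S_r E_i S_s E_j S_t` is a combination of products
`S_r E_i' S_s' E_j' S_t` with `s' < s`. -/
theorem peak_mem {d : ℕ} {θ θs : ℕ → F} (hθ : Set.InjOn θ (range (d + 1)))
    (hθs : Set.InjOn θs (range (d + 1))) {E S : ℕ → Module.End F M}
    (hS : MomentVanishing d θ E S) (hE : MomentVanishing d θs S E)
    {r s t : ℕ} (hr : r ≤ s) (ht : t < s) (hs : s ≤ d) (w : M) {K : Submodule F M}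
    (hK : ∀ u < s, ∀ i ≤ d, ∀ j ≤ d, S r (E i (S u (E j (S t w)))) ∈ K)
    {i j : ℕ} (hi : i ≤ d) (hj : j ≤ d) :
    S r (E i (S s (E j (S t w)))) ∈ K := by
  have key : ∀ n u, u + n = d → s ≤ u → ∀ i j, i ≤ d → j ≤ d →
      K.mkQ (S r (E i (S u (E j (S t w))))) = 0 := by
    intro n
    induction n using Nat.strong_induction_on with
    | _ n ih =>
    intro u hun hsu
    refine eq_zero_of_band_of_moments (k := u - s) hθ
      (b := fun i j => K.mkQ (S r (E i (S u (E j (S t w)))))) ?_ ?_ ?_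
    · intro i j hi hj hij
      have hpoly : ∀ p : F[X], p.natDegree < u - s + 1 →
          ∑ l ∈ range (d + 1), p.eval (θs l) • E i (S l (E j (S t w))) = 0 := by
        intro p hp
        simp_rw [eval_eq_sum_range' hp, sum_smul]
        rw [sum_comm]
        refine sum_eq_zero fun m hm => ?_
        simp_rw [mul_smul]
        rw [← smul_sum, hE i j m hi hj (by rw [mem_range] at hm; omega), smul_zero]
      have h := congrArg (fun x => K.mkQ (S r x)) (hpoly (∏ l ∈ Ico s u, (X - C (θs l))) (by
        rw [natDegree_finsetProd_X_sub_C_eq_card, Nat.card_Ico]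
        omega))
      simp only [map_sum, map_smul, map_zero] at h
      rw [sum_eq_single_of_mem u (mem_range.2 (by omega))] at h
      · refine (smul_eq_zero.1 h).resolve_left ?_
        rw [eval_prod]
        refine prod_ne_zero_iff.2 fun l hl => ?_
        rw [mem_Ico] at hl
        rw [eval_sub, eval_X, eval_C, sub_ne_zero]
        intro h'
        have := hθs (by simp; omega) (by simp; omega) h'
        omega
      · intro l hl hlu
        rw [mem_range] at hl
        by_cases hls : l < s
        · rw [show K.mkQ _ = 0 from (Submodule.Quotient.mk_eq_zero K).2 (hK l hls i hi j hj),
            smul_zero]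
        by_cases hlu' : l < u
        · rw [eval_prod, prod_eq_zero (mem_Ico.2 ⟨not_lt.1 hls, hlu'⟩) (by simp), zero_smul]
        · rw [ih (d - l) (by omega) l (by omega) (by omega) i j hi hj, smul_zero]
    · intro i hi m hm
      have h := congrArg (fun x => K.mkQ (S r (E i x)))
        (hS u t m (by omega) (by omega) (by omega) w)
      simpa only [map_sum, map_smul, map_zero] using h
    · intro j hj m hm
      have h := congrArg K.mkQ
        (hS r u m (by omega) (by omega) (by omega) (E j (S t w)))
      simpa only [map_sum, map_smul, map_zero] using h
  exact (Submodule.Quotient.mk_eq_zero K).1 (key (d - s) s (by omega) le_rfl i j hi hj)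

/-- The span of the vectors `S_{c_0} E_{i_1} S_{c_1} E_{i_2} ⋯ E_{i_m} v` with
`s = c_0 > c_1 > ⋯ > c_m = 0`. -/
def chainSpace (d : ℕ) (E S : ℕ → Module.End F M) (v : M) : ℕ → Submodule F M
  | 0 => Submodule.span F {v}
  | s + 1 => ⨆ t : Fin (s + 1), ⨆ i : Fin (d + 1),
      (chainSpace d E S v t).map (S (s + 1) * E i)
termination_by s => s
decreasing_by exact t.2

theorem finiteDimensional_chainSpace (d : ℕ) (E S : ℕ → Module.End F M) (v : M) (s : ℕ) :
    FiniteDimensional F (chainSpace d E S v s) := by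
  induction s using Nat.strong_induction_on with
  | _ s ih =>
  cases s with
  | zero => rw [chainSpace]; infer_instance
  | succ s =>
    rw [chainSpace]
    have (t : Fin (s + 1)) : FiniteDimensional F (chainSpace d E S v t) := ih t t.2
    infer_instance

theorem mem_chainSpace_of_lt {d : ℕ} {E S : ℕ → Module.End F M} {v w : M} {s t i : ℕ}
    (hts : t < s) (hi : i ≤ d) (hw : w ∈ chainSpace d E S v t) :
    S s (E i w) ∈ chainSpace d E S v s := by
  cases s with
  | zero => omega
  | succ s =>
    rw [chainSpace]
    exact Submodule.mem_iSup_of_mem ⟨t, hts⟩ (Submodule.mem_iSup_of_mem ⟨i, by omega⟩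
      (Submodule.mem_map_of_mem (f := S (s + 1) * E i) hw))

theorem apply_of_mem_chainSpace {d : ℕ} {E S : ℕ → Module.End F M} {v w : M} {s : ℕ}
    (hS : S s * S s = S s) (hv : S 0 v = v) (hw : w ∈ chainSpace d E S v s) : S s w = w := by
  suffices chainSpace d E S v s ≤ LinearMap.eqLocus (S s) LinearMap.id from this hw
  cases s with
  | zero =>
    rw [chainSpace, Submodule.span_singleton_le_iff_mem]
    exact hv
  | succ s =>
    rw [chainSpace]
    refine iSup_le fun t => iSup_le fun i => ?_
    rintro _ ⟨x, -, rfl⟩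
    exact LinearMap.congr_fun hS (E i x)

open Finset in
theorem mem_chainSpace {d : ℕ} {θ θs : ℕ → F} (hθ : Set.InjOn θ (range (d + 1)))
    (hθs : Set.InjOn θs (range (d + 1))) {E S : ℕ → Module.End F M}
    (hS : MomentVanishing d θ E S) (hE : MomentVanishing d θs S E)
    (hSS : ∀ s ≤ d, S s * S s = S s) {v : M} (hv : S 0 v = v)
    (hv' : ∀ i ≤ d, S 0 (E i v) ∈ Submodule.span F {v}) {s : ℕ} (hs : s ≤ d) :
    ∀ r ≤ d, ∀ i ≤ d, ∀ w ∈ chainSpace d E S v s, S r (E i w) ∈ chainSpace d E S v r := by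
  induction s using Nat.strong_induction_on with
  | _ s ih =>
  intro r hr i hi w hw
  by_cases hsr : s < r
  · exact mem_chainSpace_of_lt hsr hi hw
  suffices chainSpace d E S v s ≤ (chainSpace d E S v r).comap (S r * E i) from this hw
  cases s with
  | zero =>
    obtain rfl : r = 0 := by omega
    rw [chainSpace, Submodule.span_singleton_le_iff_mem]
    exact hv' i hi
  | succ s =>
    rw [chainSpace]
    refine iSup_le fun t => iSup_le fun j => ?_
    rintro _ ⟨x, hx, rfl⟩
    have htd : (t : ℕ) ≤ d := by omega
    have hxt : S t x = x := apply_of_mem_chainSpace (hSS t htd) hv hx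
    change S r (E i (S (s + 1) (E j x))) ∈ chainSpace d E S v r
    rw [← hxt]
    refine peak_mem hθ hθs hS hE (by omega) t.2 hs x ?_ hi (by omega)
    intro u hu i' hi' j' hj'
    rw [hxt]
    exact ih u hu (by omega) r hr i' hi' _ (ih t t.2 htd u (by omega) j' hj' x hx)

end Tridiagonal

section Relations

variable {F : Type*} [Field F] {d : ℕ} {θ θs : ℕ → F}

theorem eT_of_le {i : ℕ} (hi : i ≤ d) :
    eT F d θ θs i = tgen F d θ θs (TGen.e ⟨i, Nat.lt_succ_of_le hi⟩) :=
  dif_pos (Nat.lt_succ_of_le hi)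

theorem esT_of_le {i : ℕ} (hi : i ≤ d) :
    esT F d θ θs i = tgen F d θ θs (TGen.estar ⟨i, Nat.lt_succ_of_le hi⟩) :=
  dif_pos (Nat.lt_succ_of_le hi)

theorem eT_mul_eT {i j : ℕ} (hi : i ≤ d) (hj : j ≤ d) :
    eT F d θ θs i * eT F d θ θs j = if i = j then eT F d θ θs i else 0 := by
  have h := RingQuot.mkAlgHom_rel F (TRel.ee (θ := θ) (θs := θs)
    ⟨i, Nat.lt_succ_of_le hi⟩ ⟨j, Nat.lt_succ_of_le hj⟩)
  rw [eT_of_le hi, eT_of_le hj, tgen, tgen, ← map_mul, h]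
  simp only [Fin.mk.injEq]
  split_ifs <;> simp

theorem esT_mul_esT {i j : ℕ} (hi : i ≤ d) (hj : j ≤ d) :
    esT F d θ θs i * esT F d θ θs j = if i = j then esT F d θ θs i else 0 := by
  have h := RingQuot.mkAlgHom_rel F (TRel.eses (θ := θ) (θs := θs)
    ⟨i, Nat.lt_succ_of_le hi⟩ ⟨j, Nat.lt_succ_of_le hj⟩)
  rw [esT_of_le hi, esT_of_le hj, tgen, tgen, ← map_mul, h]
  simp only [Fin.mk.injEq]
  split_ifs <;> simp

theorem sum_eT : ∑ i ∈ Finset.range (d + 1), eT F d θ θs i = 1 := by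
  have h := RingQuot.mkAlgHom_rel F (TRel.sum_e (F := F) (d := d) (θ := θ) (θs := θs))
  rw [map_sum, map_one] at h
  rw [Finset.sum_range, ← h]
  exact Finset.sum_congr rfl fun i _ => eT_of_le (Nat.lt_succ_iff.1 i.2)

theorem sum_esT : ∑ i ∈ Finset.range (d + 1), esT F d θ θs i = 1 := by
  have h := RingQuot.mkAlgHom_rel F (TRel.sum_estar (F := F) (d := d) (θ := θ) (θs := θs))
  rw [map_sum, map_one] at h
  rw [Finset.sum_range, ← h]
  exact Finset.sum_congr rfl fun i _ => esT_of_le (Nat.lt_succ_iff.1 i.2)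

theorem aT_eq_sum : aT F d θ θs = ∑ i ∈ Finset.range (d + 1), θ i • eT F d θ θs i := by
  have h := RingQuot.mkAlgHom_rel F (TRel.a_eq (F := F) (d := d) (θ := θ) (θs := θs))
  rw [aT, tgen, h, map_sum, Finset.sum_range]
  refine Finset.sum_congr rfl fun i _ => ?_
  rw [map_smul, eT_of_le (Nat.lt_succ_iff.1 i.2)]
  rfl

theorem asT_eq_sum : asT F d θ θs = ∑ i ∈ Finset.range (d + 1), θs i • esT F d θ θs i := by
  have h := RingQuot.mkAlgHom_rel F (TRel.astar_eq (F := F) (d := d) (θ := θ) (θs := θs))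
  rw [asT, tgen, h, map_sum, Finset.sum_range]
  refine Finset.sum_congr rfl fun i _ => ?_
  rw [map_smul, esT_of_le (Nat.lt_succ_iff.1 i.2)]
  rfl

/-- Powers of a combination of orthogonal idempotents summing to `1`. -/
theorem sum_smul_idempotents_pow {A : Type*} [Ring A] [Algebra F A] {e : ℕ → A}
    (he : ∀ i j, i ≤ d → j ≤ d → e i * e j = if i = j then e i else 0)
    (hsum : ∑ i ∈ Finset.range (d + 1), e i = 1) (c : ℕ → F) (m : ℕ) :
    (∑ i ∈ Finset.range (d + 1), c i • e i) ^ m =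
      ∑ i ∈ Finset.range (d + 1), c i ^ m • e i := by
  induction m with
  | zero => simp [hsum]
  | succ m ih =>
    rw [pow_succ, ih, Finset.sum_mul_sum]
    refine Finset.sum_congr rfl fun i hi => ?_
    rw [Finset.sum_eq_single_of_mem i hi]
    · rw [smul_mul_smul_comm, he i i (by simp at hi; omega) (by simp at hi; omega), if_pos rfl,
        pow_succ]
    · intro j hj hji
      rw [smul_mul_smul_comm, he i j (by simp at hi; omega) (by simp at hj; omega),
        if_neg hji.symm, smul_zero]

theorem esT_mul_aT_pow_mul_esT {r s m : ℕ} (hr : r ≤ d) (hs : s ≤ d)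
    (hm : m < max (r - s) (s - r)) :
    esT F d θ θs r * aT F d θ θs ^ m * esT F d θ θs s = 0 := by
  have h := RingQuot.mkAlgHom_rel F (TRel.trid (F := F) (θ := θ) (θs := θs)
    ⟨r, Nat.lt_succ_of_le hr⟩ ⟨s, Nat.lt_succ_of_le hs⟩ m (by omega) hm)
  rwa [map_mul, map_mul, map_pow, map_zero, ← tgen, ← tgen, ← tgen, ← esT_of_le hr,
    ← esT_of_le hs, ← aT] at h

theorem eT_mul_asT_pow_mul_eT {r s m : ℕ} (hr : r ≤ d) (hs : s ≤ d)
    (hm : m < max (r - s) (s - r)) :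
    eT F d θ θs r * asT F d θ θs ^ m * eT F d θ θs s = 0 := by
  have h := RingQuot.mkAlgHom_rel F (TRel.tridstar (F := F) (θ := θ) (θs := θs)
    ⟨r, Nat.lt_succ_of_le hr⟩ ⟨s, Nat.lt_succ_of_le hs⟩ m (by omega) hm)
  rwa [map_mul, map_mul, map_pow, map_zero, ← tgen, ← tgen, ← tgen, ← eT_of_le hr,
    ← eT_of_le hs, ← asT] at h

/-- `T` is generated by the idempotents `e_i` and `e*_i`. -/
theorem adjoin_idempotents_eq_top :
    Algebra.adjoin F (eT F d θ θs '' Set.Iic d ∪ esT F d θ θs '' Set.Iic d) = ⊤ := by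
  set B := Algebra.adjoin F (eT F d θ θs '' Set.Iic d ∪ esT F d θ θs '' Set.Iic d)
  have he : ∀ i ≤ d, eT F d θ θs i ∈ B := fun i hi =>
    Algebra.subset_adjoin (Or.inl ⟨i, hi, rfl⟩)
  have hes : ∀ i ≤ d, esT F d θ θs i ∈ B := fun i hi =>
    Algebra.subset_adjoin (Or.inr ⟨i, hi, rfl⟩)
  rw [eq_top_iff]
  rintro x -
  obtain ⟨y, rfl⟩ := RingQuot.mkAlgHom_surjective F (TRel F d θ θs) x
  induction y using FreeAlgebra.induction with
  | grade0 c => rw [AlgHom.commutes]; exact B.algebraMap_mem c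
  | mul y z hy hz => rw [map_mul]; exact B.mul_mem hy hz
  | add y z hy hz => rw [map_add]; exact B.add_mem hy hz
  | grade1 g =>
    cases g with
    | a =>
      change aT F d θ θs ∈ B
      rw [aT_eq_sum]
      exact B.sum_mem fun i hi => B.smul_mem (he i (Nat.lt_succ_iff.1 (Finset.mem_range.1 hi))) _
    | astar =>
      change asT F d θ θs ∈ B
      rw [asT_eq_sum]
      exact B.sum_mem fun i hi => B.smul_mem (hes i (Nat.lt_succ_iff.1 (Finset.mem_range.1 hi))) _
    | e i =>
      have h := he i (Nat.lt_succ_iff.1 i.2)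
      rwa [eT_of_le (Nat.lt_succ_iff.1 i.2)] at h
    | estar i =>
      have h := hes i (Nat.lt_succ_iff.1 i.2)
      rwa [esT_of_le (Nat.lt_succ_iff.1 i.2)] at h

theorem aeval_aT (p : F[X]) :
    aeval (aT F d θ θs) p = ∑ i ∈ Finset.range (d + 1), p.eval (θ i) • eT F d θ θs i := by
  rw [aeval_eq_sum_range]
  simp_rw [aT_eq_sum, sum_smul_idempotents_pow (fun i j => eT_mul_eT) sum_eT, eval_eq_sum_range,
    Finset.sum_smul, Finset.smul_sum, mul_smul]
  exact Finset.sum_comm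

open Finset in
/-- A subspace containing `τ_0(a), …, τ_d(a)` contains every `e_i`. -/
theorem eT_mem_of_aeval_tauPoly_mem (hθ : Set.InjOn θ (range (d + 1)))
    {W : Submodule F (TAlg F d θ θs)}
    (hW : ∀ k ≤ d, aeval (aT F d θ θs) (tauPoly θ k) ∈ W) {i : ℕ} (hi : i ≤ d) :
    eT F d θ θs i ∈ W := by
  obtain ⟨n, hn⟩ := Nat.exists_eq_add_of_le hi
  induction n using Nat.strong_induction_on generalizing i with
  | _ n ih =>
  have h := hW i hi
  rw [aeval_aT, ← add_sum_erase _ _ (mem_range.2 (Nat.lt_succ_of_le hi))] at h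
  have hne : (tauPoly θ i).eval (θ i) ≠ 0 := by
    rw [tauPoly, eval_prod]
    refine prod_ne_zero_iff.2 fun l hl => ?_
    rw [mem_range] at hl
    rw [eval_sub, eval_X, eval_C, sub_ne_zero]
    intro h'
    have := hθ (by simp; omega) (by simp; omega) h'
    omega
  rw [Submodule.add_mem_iff_left, Submodule.smul_mem_iff _ hne] at h
  · exact h
  refine W.sum_mem fun l hl => ?_
  obtain ⟨hli, hld⟩ := mem_erase.1 hl
  rw [mem_range] at hld
  by_cases hlt : l < i
  · rw [tauPoly, eval_prod, prod_eq_zero (mem_range.2 hlt) (by simp), zero_smul]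
    exact W.zero_mem
  · exact W.smul_mem _ (ih (d - l) (by omega) (by omega) (by omega))

end Relations

section Module

variable {F : Type*} [Field F] {d : ℕ} {θ θs : ℕ → F} {M : Type*} [AddCommGroup M] [Module F M]
  [Module (TAlg F d θ θs) M] [IsScalarTower F (TAlg F d θ θs) M]

theorem momentVanishing_eT_esT :
    MomentVanishing d θ (fun i => Algebra.lsmul F F M (eT F d θ θs i))
      (fun i => Algebra.lsmul F F M (esT F d θ θs i)) := by
  intro r s m hr hs hm x
  have h := congrArg (· • x) (esT_mul_aT_pow_mul_esT (F := F) (θ := θ) (θs := θs) hr hs hm)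
  rw [aT_eq_sum, sum_smul_idempotents_pow (fun i j => eT_mul_eT) sum_eT] at h
  simpa [Finset.mul_sum, Finset.sum_mul, Finset.sum_smul, mul_smul] using h

theorem momentVanishing_esT_eT :
    MomentVanishing d θs (fun i => Algebra.lsmul F F M (esT F d θ θs i))
      (fun i => Algebra.lsmul F F M (eT F d θ θs i)) := by
  intro r s m hr hs hm x
  have h := congrArg (· • x) (eT_mul_asT_pow_mul_eT (F := F) (θ := θ) (θs := θs) hr hs hm)
  rw [asT_eq_sum, sum_smul_idempotents_pow (fun i j => esT_mul_esT) sum_esT] at h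
  simpa [Finset.mul_sum, Finset.sum_mul, Finset.sum_smul, mul_smul] using h

open Finset in
/-- A cyclic `T`-module generated by a vector `v` with `e*_0 v = v` and `e*_0 τ_i(a) v ∈ F v` for
all `i` is finite-dimensional. -/
theorem finiteDimensional_of_cyclic (hθ : Set.InjOn θ (range (d + 1)))
    (hθs : Set.InjOn θs (range (d + 1))) {v : M} (hv : esT F d θ θs 0 • v = v)
    (hτ : ∀ k ≤ d, esT F d θ θs 0 • aeval (aT F d θ θs) (tauPoly θ k) • v ∈
      Submodule.span F {v})
    (hcyc : ∀ x : M, ∃ t : TAlg F d θ θs, t • v = x) : FiniteDimensional F M := by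
  set E : ℕ → Module.End F M := fun i => Algebra.lsmul F F M (eT F d θ θs i)
  set S : ℕ → Module.End F M := fun i => Algebra.lsmul F F M (esT F d θ θs i) with hSdef
  have hSS : ∀ s ≤ d, S s * S s = S s := by
    intro s hs
    rw [hSdef]
    simp only
    rw [← map_mul, esT_mul_esT hs hs, if_pos rfl]
  have hv' : ∀ i ≤ d, S 0 (E i v) ∈ Submodule.span F {v} := fun i hi =>
    eT_mem_of_aeval_tauPoly_mem hθ (W := (Submodule.span F {v}).comap
      (S 0 ∘ₗ (applyVec v : TAlg F d θ θs →ₗ[F] M))) hτ hi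
  have hmem {s : ℕ} (hs : s ≤ d) := mem_chainSpace hθ hθs (momentVanishing_eT_esT (M := M))
    momentVanishing_esT_eT hSS hv hv' hs
  let W : Submodule F M := ⨆ s : Fin (d + 1), chainSpace d E S v s
  have hle {s : ℕ} (hs : s ≤ d) : chainSpace d E S v s ≤ W :=
    le_iSup (fun s : Fin (d + 1) => chainSpace d E S v s) ⟨s, Nat.lt_succ_of_le hs⟩
  have hWE : ∀ i ≤ d, W ≤ W.comap (E i) := by
    refine fun i hi => iSup_le fun s w hw => ?_
    have hsum : E i w = ∑ r ∈ range (d + 1), S r (E i w) := by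
      have h := congrArg (· • E i w) (sum_esT (F := F) (d := d) (θ := θ) (θs := θs))
      simp only [sum_smul, one_smul] at h
      exact h.symm
    rw [Submodule.mem_comap, hsum]
    refine W.sum_mem fun r hr => ?_
    have hr' := Nat.lt_succ_iff.1 (mem_range.1 hr)
    exact hle hr' (hmem (Nat.lt_succ_iff.1 s.2) r hr' i hi w hw)
  have hWS : ∀ i ≤ d, W ≤ W.comap (S i) := by
    refine fun i hi => iSup_le fun s w hw => ?_
    have hs := Nat.lt_succ_iff.1 s.2
    have hsw : S s w = w := apply_of_mem_chainSpace (hSS s hs) hv hw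
    rw [Submodule.mem_comap]
    by_cases his : i = s
    · rw [his, hsw]
      exact hle hs hw
    · rw [← hsw]
      have h := congrArg (· • w) (esT_mul_esT (F := F) (θ := θ) (θs := θs) hi hs)
      simp only [if_neg his, zero_smul, mul_smul] at h
      exact (congrArg (· ∈ W) h).mpr W.zero_mem
  have hW : ∀ t : TAlg F d θ θs, ∀ w ∈ W, t • w ∈ W := by
    intro t
    have ht : t ∈ Algebra.adjoin F (eT F d θ θs '' Set.Iic d ∪ esT F d θ θs '' Set.Iic d) :=
      adjoin_idempotents_eq_top (F := F) (θ := θ) (θs := θs) ▸ Algebra.mem_top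
    induction ht using Algebra.adjoin_induction with
    | mem x hx =>
      rcases hx with ⟨i, hi, rfl⟩ | ⟨i, hi, rfl⟩
      · exact fun w hw => hWE i hi hw
      · exact fun w hw => hWS i hi hw
    | algebraMap c =>
      intro w hw
      rw [algebraMap_smul]
      exact W.smul_mem c hw
    | add x y _ _ hx hy =>
      intro w hw
      rw [add_smul]
      exact W.add_mem (hx w hw) (hy w hw)
    | mul x y _ _ hx hy =>
      intro w hw
      rw [mul_smul]
      exact hx _ (hy w hw)
  have hvW : v ∈ W := hle (Nat.zero_le d) (by
    rw [chainSpace]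
    exact Submodule.mem_span_singleton_self v)
  have hWtop : W = ⊤ := eq_top_iff.2 fun x _ => by
    obtain ⟨t, rfl⟩ := hcyc x
    exact hW t v hvW
  have (s : Fin (d + 1)) : FiniteDimensional F (chainSpace d E S v s) :=
    finiteDimensional_chainSpace d E S v s
  have hfin : FiniteDimensional F W := Submodule.finite_iSup _
  rw [hWtop] at hfin
  exact Module.finite_def.2 ((Submodule.fg_top ⊤).1 (Module.finite_def.1 hfin))

end Module

/-- If `μ` is an isomorphism then the `F`-vector space `M = T/J` has finite dimension. -/
theorem stmt11 {F : Type*} [Field F] (d : ℕ) (θ θs : ℕ → F) (h : EigCond F d θ θs)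
    (μ : MvPolynomial (Fin d) F →ₗ[F] TAlg F d θ θs) (hμ : MuProps F d θ θs μ)
    (hinj : Function.Injective μ)
    (ζ : ℕ → F) (hζ : ZetaCond F d θ θs ζ) :
    FiniteDimensional F (TAlg F d θ θs ⧸ Jideal F d θ θs ζ) := by
  set J := Jideal F d θ θs ζ
  have hθ : Set.InjOn θ (Finset.range (d + 1)) := fun i hi j hj hij => by
    simp only [Finset.coe_range, Set.mem_Iio] at hi hj
    by_contra hne
    exact h.1 i j (by omega) (by omega) hne hij
  have hθs : Set.InjOn θs (Finset.range (d + 1)) := fun i hi j hj hij => by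
    simp only [Finset.coe_range, Set.mem_Iio] at hi hj
    by_contra hne
    exact h.2.1 i j (by omega) (by omega) hne hij
  let v : TAlg F d θ θs ⧸ J := J.mkQ 1
  have hsmul (t : TAlg F d θ θs) : t • v = J.mkQ t := by
    rw [← map_smul, smul_eq_mul, mul_one]
  have hv : esT F d θ θs 0 • v = v := by
    rw [hsmul]
    refine ((Submodule.Quotient.eq J).2 ?_).symm
    exact Submodule.subset_span (Or.inl rfl)
  refine finiteDimensional_of_cyclic hθ hθs hv (fun k hk => ?_) fun x => ?_
  · rcases Nat.eq_zero_or_pos k with rfl | hk0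
    · rw [tauPoly, Finset.prod_range_zero, map_one, one_smul, hv]
      exact Submodule.mem_span_singleton_self v
    · have hg : gElt F d θ θs ζ k • v = 0 := by
        rw [hsmul]
        exact (Submodule.Quotient.mk_eq_zero J).2
          (Submodule.subset_span (Or.inr ⟨k, ⟨hk0, hk⟩, rfl⟩))
      rw [gElt, sub_smul, smul_assoc, mul_smul, mul_smul, hv, sub_eq_zero] at hg
      rw [hg]
      exact Submodule.smul_mem _ _ (Submodule.mem_span_singleton_self v)
  · obtain ⟨t, rfl⟩ := J.mkQ_surjective x
    exact ⟨t, hsmul t⟩
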